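/- Let L ⊂ ℝ² ≅ ℂ be a lattice of covolume 1 and f : ℝ² → ℝ a continuous L-periodic function with f > 0 such that the metric g = f²(dx²+dy²) satisfies the boundary case of equality in Loewner's torus inequality, area(g) = (√3/2)·sys(g)². Then f is a constant function and L is homothetic to the lattice of Eisenstein integers: there exists a nonzero complex number z such that L = z·(ℤ + ℤ·e^{iπ/3}). -/

import Mathlib

open MeasureTheory intervalIntegral

/-- A path `γ : [0,1] → ℂ ≅ ℝ²` is piecewise `C¹` with derivative `γ'` if it is continuous
on `[0,1]` and there is a finite partition `0 = t₀ < t₁ < ⋯ < tₙ = 1` such that on each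
closed piece the derivative of `γ` extends to a continuous function agreeing with `γ'`
in the interior of the piece. -/
def IsPiecewiseC1Path (γ γ' : ℝ → ℂ) : Prop :=
  ContinuousOn γ (Set.Icc 0 1) ∧
  ∃ (n : ℕ) (t : ℕ → ℝ), 0 < n ∧ t 0 = 0 ∧ t n = 1 ∧
    (∀ i < n, t i < t (i + 1)) ∧
    ∀ i < n, ∃ d : ℝ → ℂ, ContinuousOn d (Set.Icc (t i) (t (i + 1))) ∧
      ∀ x ∈ Set.Ioo (t i) (t (i + 1)), HasDerivAt γ (d x) x ∧ γ' x = d x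

/-- The length of a path `γ` with derivative `γ'` in the conformal metric `f²(dx²+dy²)`. -/
noncomputable def gLength (f : ℂ → ℝ) (γ γ' : ℝ → ℂ) : ℝ :=
  ∫ t in (0:ℝ)..1, f (γ t) * ‖γ' t‖

/-- The systole of the metric `f²(dx²+dy²)` on the torus `ℝ²/L`: the infimum of lengths of
piecewise `C¹` paths whose endpoint difference is a nonzero lattice vector. -/
noncomputable def systole (L : Set ℂ) (f : ℂ → ℝ) : ℝ :=
  sInf { ℓ : ℝ | ∃ γ γ' : ℝ → ℂ, IsPiecewiseC1Path γ γ' ∧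
    γ 1 - γ 0 ∈ L ∧ γ 1 - γ 0 ≠ 0 ∧ ℓ = gLength f γ γ' }


lemma lat_pos (v w : ℂ) (h : v.re * w.im - v.im * w.re = 1) :
    ∃ a τ : ℂ, a ≠ 0 ∧ 1 ≤ τ.re ^ 2 + τ.im ^ 2 ∧ |τ.re| ≤ 1 / 2 ∧ 0 < τ.im ∧
      (a.re ^ 2 + a.im ^ 2) * τ.im = 1 ∧
      ∀ z : ℂ, (∃ m n : ℤ, z = (m : ℂ) * v + (n : ℂ) * w) ↔
        ∃ m n : ℤ, z = a * ((m : ℂ) + (n : ℂ) * τ) := by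
  have hv : v ≠ 0 := by
    rintro rfl
    simp at h
  have hnv : 0 < Complex.normSq v := Complex.normSq_pos.2 hv
  have him : 0 < (w / v).im := by
    rw [Complex.div_im, ← sub_div]
    apply div_pos _ hnv
    linarith
  obtain ⟨g, hg⟩ := ModularGroup.exists_smul_mem_fd (⟨w / v, him⟩ : UpperHalfPlane)
  have hdet : g 0 0 * g 1 1 - g 0 1 * g 1 0 = 1 := by
    have := g.det_coe
    rwa [Matrix.det_fin_two] at this
  have hdetC : (g 0 0 : ℂ) * g 1 1 - g 0 1 * g 1 0 = 1 := by exact_mod_cast hdet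
  have hdetR : (g 0 0 : ℝ) * g 1 1 - g 0 1 * g 1 0 = 1 := by exact_mod_cast hdet
  set T := g • (⟨w / v, him⟩ : UpperHalfPlane) with hT
  have hTe : (T : ℂ) = ((g 0 0 : ℂ) * (w / v) + g 0 1) / ((g 1 0 : ℂ) * (w / v) + g 1 1) := by
    rw [hT, UpperHalfPlane.coe_specialLinearGroup_apply]
    simp
  set a : ℂ := (g 1 0 : ℂ) * w + g 1 1 * v with ha
  set b : ℂ := (g 0 0 : ℂ) * w + g 0 1 * v with hb
  have hab : a.re * b.im - a.im * b.re = 1 := by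
    simp only [ha, hb, Complex.add_re, Complex.add_im, Complex.mul_re, Complex.mul_im,
      Complex.intCast_re, Complex.intCast_im]
    linear_combination (v.re * w.im - v.im * w.re) * hdetR + h
  have ha0 : a ≠ 0 := by
    intro h0
    rw [h0] at hab
    simp at hab
  have hTb : a * (T : ℂ) = b := by
    have e1 : (T : ℂ) = b / a := by
      rw [hTe]
      have : (g 1 0 : ℂ) * (w / v) + g 1 1 = a / v := by rw [ha]; field_simp
      rw [this]
      have : (g 0 0 : ℂ) * (w / v) + g 0 1 = b / v := by rw [hb]; field_simp
      rw [this]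
      field_simp
    rw [e1]; field_simp
  refine ⟨a, T, ha0, ?_, hg.2, T.im_pos, ?_, ?_⟩
  · have := hg.1
    rw [Complex.normSq_apply] at this
    nlinarith
  · rw [← hTb] at hab
    simp only [Complex.mul_re, Complex.mul_im] at hab
    linear_combination hab
  · intro z
    constructor
    · rintro ⟨m, n, rfl⟩
      refine ⟨g 0 0 * m - g 0 1 * n, - g 1 0 * m + g 1 1 * n, ?_⟩
      push_cast
      rw [mul_add, mul_left_comm, hTb, ha, hb]
      linear_combination (-(m * v) - n * w) * hdetC
    · rintro ⟨m, n, rfl⟩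
      refine ⟨m * g 1 1 + n * g 0 1, m * g 1 0 + n * g 0 0, ?_⟩
      push_cast
      rw [mul_add, mul_left_comm, hTb, ha, hb]
      ring

lemma lat_red (v w : ℂ) (h : |v.re * w.im - v.im * w.re| = 1) :
    ∃ a τ : ℂ, a ≠ 0 ∧ 1 ≤ τ.re ^ 2 + τ.im ^ 2 ∧ |τ.re| ≤ 1 / 2 ∧ 0 < τ.im ∧
      (a.re ^ 2 + a.im ^ 2) * τ.im = 1 ∧
      ∀ z : ℂ, (∃ m n : ℤ, z = (m : ℂ) * v + (n : ℂ) * w) ↔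
        ∃ m n : ℤ, z = a * ((m : ℂ) + (n : ℂ) * τ) := by
  rcases (abs_eq zero_le_one).1 h with h | h
  · exact lat_pos v w h
  · obtain ⟨a, τ, h1, h2, h3, h4, h5, h6⟩ := lat_pos w v (by linarith)
    refine ⟨a, τ, h1, h2, h3, h4, h5, fun z => ?_⟩
    rw [← h6 z]
    constructor
    · rintro ⟨m, n, rfl⟩
      exact ⟨n, m, by ring⟩
    · rintro ⟨m, n, rfl⟩
      exact ⟨n, m, by ring⟩

lemma swap_cont (F : ℝ → ℝ → ℝ) (hF : Continuous (Function.uncurry F)) :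
    ∫ s in (0:ℝ)..1, ∫ t in (0:ℝ)..1, F s t = ∫ t in (0:ℝ)..1, ∫ s in (0:ℝ)..1, F s t := by
  apply MeasureTheory.intervalIntegral_intervalIntegral_swap
  have : IntegrableOn (Function.uncurry F) (Set.uIcc (0:ℝ) 1 ×ˢ Set.uIcc (0:ℝ) 1)
      volume :=
    hF.continuousOn.integrableOn_compact (isCompact_uIcc.prod isCompact_uIcc)
  exact this.mono_set (Set.prod_mono Set.uIoc_subset_uIcc Set.uIoc_subset_uIcc)

lemma shift_mean (F : ℝ → ℝ → ℝ) (h1 : ∀ s t, F (s + 1) t = F s t)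
    (h2 : ∀ s t, F s (t + 1) = F s t) (α β : ℝ) :
    ∫ s in (0:ℝ)..1, ∫ t in (0:ℝ)..1, F (s + α) (t + β) =
      ∫ s in (0:ℝ)..1, ∫ t in (0:ℝ)..1, F s t := by
  have e1 : ∀ s, ∫ t in (0:ℝ)..1, F s (t + β) = ∫ t in (0:ℝ)..1, F s t := by
    intro s
    rw [intervalIntegral.integral_comp_add_right (fun t => F s t)]
    have := Function.Periodic.intervalIntegral_add_eq (f := F s) (T := 1) (h2 s) β 0
    rw [zero_add] at this
    rw [zero_add, add_comm 1 β, this]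
  simp_rw [e1]
  rw [intervalIntegral.integral_comp_add_right (fun s => ∫ t in (0:ℝ)..1, F s t)]
  have := Function.Periodic.intervalIntegral_add_eq
    (f := fun s => ∫ t in (0:ℝ)..1, F s t) (T := 1) (fun s => by simp only [h1]) α 0
  rw [zero_add] at this
  rw [zero_add, add_comm 1 α, this]

lemma glen_nonneg (f : ℂ → ℝ) (hfpos : ∀ z, 0 < f z) (γ γ' : ℝ → ℂ) : 0 ≤ gLength f γ γ' :=
  intervalIntegral.integral_nonneg zero_le_one
    fun _ _ => mul_nonneg (hfpos _).le (norm_nonneg _)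

lemma sys_nonneg (L : Set ℂ) (f : ℂ → ℝ) (hfpos : ∀ z, 0 < f z) : 0 ≤ systole L f := by
  apply Real.sInf_nonneg
  rintro ℓ ⟨γ, γ', -, -, -, rfl⟩
  exact glen_nonneg f hfpos γ γ'

lemma sys_le_line (L : Set ℂ) (f : ℂ → ℝ) (hfpos : ∀ z, 0 < f z) (x u : ℂ) (hu : u ∈ L)
    (hu0 : u ≠ 0) : systole L f ≤ ∫ r in (0:ℝ)..1, f (x + r * u) * ‖u‖ := by
  apply csInf_le
  · refine ⟨0, ?_⟩
    rintro ℓ ⟨γ, γ', -, -, -, rfl⟩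
    exact glen_nonneg f hfpos γ γ'
  · refine ⟨fun r => x + r * u, fun _ => u, ⟨by fun_prop, 1, fun i => i, by norm_num, by simp,
      by simp, fun i _ => by simp, fun i _ => ⟨fun _ => u, continuousOn_const, fun y _ => ?_⟩⟩,
      by simpa using hu, by simpa using hu0, rfl⟩
    refine ⟨?_, rfl⟩
    have h := ((Complex.ofRealCLM.hasDerivAt (x := y)).mul_const u).const_add x
    simpa using h

lemma zero_of_int (G : ℝ → ℝ) (hG : Continuous G) (h0 : ∀ x, 0 ≤ G x)
    (hi : ∫ s in (0:ℝ)..1, G s ≤ 0) : ∀ s ∈ Set.Icc (0:ℝ) 1, G s = 0 := by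
  intro s hs
  by_contra hne
  have : 0 < ∫ s in (0:ℝ)..1, G s :=
    intervalIntegral.integral_pos zero_lt_one hG.continuousOn (fun x _ => h0 x)
      ⟨s, hs, lt_of_le_of_ne (h0 s) (Ne.symm hne)⟩
  linarith

lemma cont_inner {X : Type*} [TopologicalSpace X] (F : X → ℝ → ℝ)
    (hF : Continuous (Function.uncurry F)) :
    Continuous fun s => ∫ t in (0:ℝ)..1, F s t :=
  intervalIntegral.continuous_parametric_intervalIntegral_of_continuous' hF 0 1

lemma sys_le_mean (L : Set ℂ) (f : ℂ → ℝ) (hf : Continuous f) (hfpos : ∀ z, 0 < f z)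
    (v w : ℂ) (hv : ∀ x, f (x + v) = f x) (hw : ∀ x, f (x + w) = f x) (m n : ℤ)
    (hu : (m : ℂ) * v + n * w ∈ L) (hu0 : (m : ℂ) * v + n * w ≠ 0) :
    systole L f ≤ (∫ s in (0:ℝ)..1, ∫ t in (0:ℝ)..1, f ((s : ℂ) * v + (t : ℂ) * w)) *
      ‖(m : ℂ) * v + n * w‖ := by
  set F : ℝ → ℝ → ℝ := fun s t => f ((s : ℂ) * v + (t : ℂ) * w) with hF
  set u := (m : ℂ) * v + n * w with hudef
  have hFc : Continuous (Function.uncurry F) := by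
    simp only [hF, Function.uncurry_def]
    fun_prop
  have hFc' : Continuous fun p : ℝ × ℝ => F p.1 p.2 := hFc
  have h1 : ∀ s t, F (s + 1) t = F s t := by
    intro s t
    simp only [hF]
    rw [← hv ((s : ℂ) * v + (t : ℂ) * w)]
    congr 1
    push_cast
    ring
  have h2 : ∀ s t, F s (t + 1) = F s t := by
    intro s t
    simp only [hF]
    rw [← hw ((s : ℂ) * v + (t : ℂ) * w)]
    congr 1
    push_cast
    ring
  have key : ∀ s t : ℝ, systole L f ≤ ∫ r in (0:ℝ)..1, F (s + r * m) (t + r * n) * ‖u‖ := by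
    intro s t
    refine (sys_le_line L f hfpos ((s : ℂ) * v + t * w) u hu hu0).trans_eq ?_
    congr 1
    ext r
    simp only [hF]
    congr 2
    rw [hudef]
    push_cast
    ring
  have c3 : Continuous fun p : ℝ × ℝ × ℝ => F (p.1 + p.2.2 * m) (p.2.1 + p.2.2 * n) * ‖u‖ := by
    simp only [hF]
    fun_prop
  have c2 : Continuous fun p : ℝ × ℝ => ∫ r in (0:ℝ)..1, F (p.1 + r * m) (p.2 + r * n) * ‖u‖ := by
    apply cont_inner (fun (p : ℝ × ℝ) (r : ℝ) => F (p.1 + r * m) (p.2 + r * n) * ‖u‖)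
    exact c3.comp (f := fun q : (ℝ × ℝ) × ℝ => (q.1.1, q.1.2, q.2)) (by fun_prop)
  have c1 : Continuous fun s : ℝ =>
      ∫ t in (0:ℝ)..1, ∫ r in (0:ℝ)..1, F (s + r * m) (t + r * n) * ‖u‖ :=
    cont_inner (fun (s t : ℝ) => ∫ r in (0:ℝ)..1, F (s + r * m) (t + r * n) * ‖u‖) c2
  have c2' : Continuous fun p : ℝ × ℝ => ∫ t in (0:ℝ)..1, F (p.1 + p.2 * m) (t + p.2 * n) * ‖u‖ := by
    apply cont_inner (fun (p : ℝ × ℝ) (t : ℝ) => F (p.1 + p.2 * m) (t + p.2 * n) * ‖u‖)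
    exact c3.comp (f := fun q : (ℝ × ℝ) × ℝ => (q.1.1, q.2, q.1.2)) (by fun_prop)
  have step1 : systole L f ≤ ∫ s in (0:ℝ)..1, ∫ t in (0:ℝ)..1, ∫ r in (0:ℝ)..1,
      F (s + r * m) (t + r * n) * ‖u‖ := by
    have : ∀ s, systole L f ≤ ∫ t in (0:ℝ)..1, ∫ r in (0:ℝ)..1,
        F (s + r * m) (t + r * n) * ‖u‖ := by
      intro s
      have := intervalIntegral.integral_mono_on (μ := volume) (a := 0) (b := 1) zero_le_one
        (f := fun _ => systole L f)
        (g := fun t => ∫ r in (0:ℝ)..1, F (s + r * m) (t + r * n) * ‖u‖)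
        (continuous_const.intervalIntegrable _ _)
        (Continuous.intervalIntegrable
          (c2.comp (f := fun t : ℝ => (s, t)) (by fun_prop)) _ _)
        (fun t _ => key s t)
      simpa using this
    have := intervalIntegral.integral_mono_on (μ := volume) (a := 0) (b := 1) zero_le_one
        (f := fun _ => systole L f)
        (g := fun s => ∫ t in (0:ℝ)..1, ∫ r in (0:ℝ)..1, F (s + r * m) (t + r * n) * ‖u‖)
        (continuous_const.intervalIntegrable _ _) (c1.intervalIntegrable _ _)
        (fun s _ => this s)
    simpa using this
  refine step1.trans_eq ?_
  have sw1 : ∀ s : ℝ, ∫ t in (0:ℝ)..1, ∫ r in (0:ℝ)..1, F (s + r * m) (t + r * n) * ‖u‖ =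
      ∫ r in (0:ℝ)..1, ∫ t in (0:ℝ)..1, F (s + r * m) (t + r * n) * ‖u‖ := by
    intro s
    apply swap_cont (fun t r => F (s + r * m) (t + r * n) * ‖u‖)
    exact c3.comp (f := fun q : ℝ × ℝ => (s, q.1, q.2)) (by fun_prop)
  simp_rw [sw1]
  rw [swap_cont (fun s r => ∫ t in (0:ℝ)..1, F (s + r * m) (t + r * n) * ‖u‖) c2']
  simp_rw [intervalIntegral.integral_mul_const, shift_mean F h1 h2]
  rw [intervalIntegral.integral_const]
  simp [hF]

lemma eis_eq (τ : ℂ) (hre : τ.re = 1 / 2 ∨ τ.re = -(1 / 2)) (him : τ.im = Real.sqrt 3 / 2) (a z : ℂ) :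
    (∃ m n : ℤ, z = a * ((m : ℂ) + (n : ℂ) * τ)) ↔
    ∃ m n : ℤ, z = a * ((m : ℂ) + (n : ℂ) * Complex.exp (Real.pi / 3 * Complex.I)) := by
  have hw : Complex.exp (Real.pi / 3 * Complex.I) = ⟨1 / 2, Real.sqrt 3 / 2⟩ := by
    have : ((Real.pi : ℂ) / 3) = ((Real.pi / 3 : ℝ) : ℂ) := by push_cast; rfl
    rw [this]
    apply Complex.ext
    · rw [Complex.exp_ofReal_mul_I_re, Real.cos_pi_div_three]
    · rw [Complex.exp_ofReal_mul_I_im, Real.sin_pi_div_three]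
  rcases hre with hre | hre
  · have : τ = Complex.exp (Real.pi / 3 * Complex.I) := by
      rw [hw]
      exact Complex.ext hre him
    rw [this]
  · have : τ = Complex.exp (Real.pi / 3 * Complex.I) - 1 := by
      rw [hw]
      apply Complex.ext
      · simp [hre]; norm_num
      · simp [him]
    rw [this]
    constructor
    · rintro ⟨m, n, rfl⟩
      exact ⟨m - n, n, by push_cast; ring⟩
    · rintro ⟨m, n, rfl⟩
      exact ⟨m + n, n, by push_cast; ring⟩

/-- **Equality case of Loewner's torus inequality.**
If a metric `g = f²(dx²+dy²)` over a unit-covolume lattice `L = ℤv + ℤw ⊂ ℂ` satisfies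
`area(g) = (√3/2)·sys(g)²`, then `f` is constant and `L` is homothetic to the lattice of
Eisenstein integers `ℤ + ℤ·e^{iπ/3}`. -/
theorem loewner_equality_case
    (v w : ℂ) (hcovol : |v.re * w.im - v.im * w.re| = 1)
    (L : Set ℂ) (hL : L = {z : ℂ | ∃ m n : ℤ, z = (m : ℂ) * v + (n : ℂ) * w})
    (f : ℂ → ℝ) (hf : Continuous f) (hfpos : ∀ z, 0 < f z)
    (hper : ∀ z ∈ L, ∀ x : ℂ, f (x + z) = f x)
    (area mean var : ℝ)
    (harea : area = ∫ s in (0:ℝ)..1, ∫ t in (0:ℝ)..1, (f ((s : ℂ) * v + (t : ℂ) * w)) ^ 2)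
    (hmean : mean = ∫ s in (0:ℝ)..1, ∫ t in (0:ℝ)..1, f ((s : ℂ) * v + (t : ℂ) * w))
    (hvar : var = ∫ s in (0:ℝ)..1, ∫ t in (0:ℝ)..1,
      (f ((s : ℂ) * v + (t : ℂ) * w) - mean) ^ 2)
    (hequality : area = Real.sqrt 3 / 2 * systole L f ^ 2) :
    (∀ z₁ z₂ : ℂ, f z₁ = f z₂) ∧
    ∃ c : ℂ, c ≠ 0 ∧
      L = {u : ℂ | ∃ m n : ℤ,
        u = c * ((m : ℂ) + (n : ℂ) * Complex.exp (Real.pi / 3 * Complex.I))} := by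
  have hmem : ∀ m n : ℤ, (m : ℂ) * v + n * w ∈ L := fun m n => by rw [hL]; exact ⟨m, n, rfl⟩
  have hv : ∀ x, f (x + v) = f x := hper v (by simpa using hmem 1 0)
  have hw : ∀ x, f (x + w) = f x := hper w (by simpa using hmem 0 1)
  obtain ⟨a, τ, ha0, hτ, hre, him, hdet, hlat⟩ := lat_red v w hcovol
  obtain ⟨m, n, hmn⟩ := (hlat a).2 ⟨1, 0, by simp⟩
  have hsys := sys_le_mean L f hf hfpos v w hv hw m n (hmem m n) (hmn ▸ ha0)
  rw [← hmean, ← hmn] at hsys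
  have hs0 := sys_nonneg L f hfpos
  have hna : ‖a‖ ^ 2 = a.re ^ 2 + a.im ^ 2 := by
    rw [Complex.sq_norm, Complex.normSq_apply]; ring
  have hFc : Continuous fun p : ℝ × ℝ => f ((p.1 : ℂ) * v + (p.2 : ℂ) * w) := by fun_prop
  have hFc1 : ∀ s : ℝ, Continuous fun t : ℝ => f ((s : ℂ) * v + (t : ℂ) * w) := by
    intro s; fun_prop
  have hI1 : Continuous fun s : ℝ => ∫ t in (0:ℝ)..1, f ((s : ℂ) * v + (t : ℂ) * w) :=
    cont_inner (fun s t : ℝ => f ((s : ℂ) * v + (t : ℂ) * w)) hFc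
  have hI2 : Continuous fun s : ℝ => ∫ t in (0:ℝ)..1, f ((s : ℂ) * v + (t : ℂ) * w) ^ 2 :=
    cont_inner (fun s t : ℝ => f ((s : ℂ) * v + (t : ℂ) * w) ^ 2) (hFc.pow 2)
  have hI3 : Continuous fun s : ℝ =>
      ∫ t in (0:ℝ)..1, (f ((s : ℂ) * v + (t : ℂ) * w) - mean) ^ 2 :=
    cont_inner (fun s t : ℝ => (f ((s : ℂ) * v + (t : ℂ) * w) - mean) ^ 2)
      ((hFc.sub continuous_const).pow 2)
  have hmpos : 0 < mean := by
    rw [hmean]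
    have hin : ∀ s : ℝ, 0 < ∫ t in (0:ℝ)..1, f ((s : ℂ) * v + (t : ℂ) * w) := fun s =>
      intervalIntegral.integral_pos zero_lt_one (hFc1 s).continuousOn
        (fun t _ => (hfpos _).le) ⟨0, by simp, hfpos _⟩
    exact intervalIntegral.integral_pos zero_lt_one hI1.continuousOn
        (fun t _ => (hin _).le) ⟨0, by simp, hin _⟩
  have hvareq : var = area - mean ^ 2 := by
    have e1 : ∀ s : ℝ, ∫ t in (0:ℝ)..1, (f ((s : ℂ) * v + (t : ℂ) * w) - mean) ^ 2 =
        (∫ t in (0:ℝ)..1, f ((s : ℂ) * v + (t : ℂ) * w) ^ 2) -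
        2 * mean * (∫ t in (0:ℝ)..1, f ((s : ℂ) * v + (t : ℂ) * w)) + mean ^ 2 := by
      intro s
      have e : ∀ t : ℝ, (f ((s : ℂ) * v + (t : ℂ) * w) - mean) ^ 2 =
        f ((s : ℂ) * v + (t : ℂ) * w) ^ 2 - 2 * mean * f ((s : ℂ) * v + (t : ℂ) * w) + mean ^ 2 := by
        intro t; ring
      simp_rw [e]
      have i1 : IntervalIntegrable (fun t : ℝ => f ((s : ℂ) * v + (t : ℂ) * w) ^ 2) volume 0 1 :=
        ((hFc1 s).pow 2).intervalIntegrable _ _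
      have i2 : IntervalIntegrable (fun t : ℝ => 2 * mean * f ((s : ℂ) * v + (t : ℂ) * w))
          volume 0 1 := ((hFc1 s).const_mul _).intervalIntegrable _ _
      rw [intervalIntegral.integral_add (i1.sub i2) (continuous_const.intervalIntegrable _ _),
        intervalIntegral.integral_sub i1 i2, intervalIntegral.integral_const_mul]
      simp
    rw [hvar]
    simp_rw [e1]
    have i1 := hI2.intervalIntegrable (μ := volume) 0 1
    have i2 := (hI1.const_mul (2 * mean)).intervalIntegrable (μ := volume) 0 1
    rw [intervalIntegral.integral_add (i1.sub i2) (continuous_const.intervalIntegrable _ _),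
        intervalIntegral.integral_sub i1 i2, intervalIntegral.integral_const_mul,
        ← hmean, ← harea]
    simp
    ring
  have hvar0 : 0 ≤ var := by
    rw [hvar]
    exact intervalIntegral.integral_nonneg zero_le_one fun s _ =>
      intervalIntegral.integral_nonneg zero_le_one fun t _ => sq_nonneg _
  have h3 : Real.sqrt 3 ^ 2 = 3 := Real.sq_sqrt (by norm_num)
  have h3p : 0 < Real.sqrt 3 := Real.sqrt_pos.2 (by norm_num)
  have hre2 : τ.re ^ 2 ≤ 1 / 4 := by
    have := sq_le_sq' (abs_le.1 hre).1 (abs_le.1 hre).2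
    linarith
  have him1 : Real.sqrt 3 / 2 ≤ τ.im := by
    by_contra hlt
    push Not at hlt
    nlinarith
  have hsq : systole L f ^ 2 ≤ mean ^ 2 * ‖a‖ ^ 2 := by
    rw [← mul_pow]
    exact pow_le_pow_left₀ hs0 hsys 2
  have hA : area ≤ Real.sqrt 3 / 2 * ‖a‖ ^ 2 * mean ^ 2 := by
    rw [hequality]
    have := mul_le_mul_of_nonneg_left hsq (by positivity : 0 ≤ Real.sqrt 3 / 2)
    linarith
  have hap : 0 < ‖a‖ ^ 2 := by positivity
  rw [← hna] at hdet
  have hm2 : 0 < mean ^ 2 := by positivity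
  have hle1 : Real.sqrt 3 / 2 * ‖a‖ ^ 2 ≤ 1 := by nlinarith
  have hvle : var ≤ 0 := by nlinarith
  have hge1 : 1 ≤ Real.sqrt 3 / 2 * ‖a‖ ^ 2 := by
    by_contra hlt
    push Not at hlt
    nlinarith
  have himeq : τ.im = Real.sqrt 3 / 2 := by
    apply le_antisymm _ him1
    by_contra hlt
    push Not at hlt
    nlinarith
  have hreeq : τ.re = 1 / 2 ∨ τ.re = -(1 / 2) := by
    apply sq_eq_sq_iff_eq_or_eq_neg.1
    rw [himeq] at hτ
    nlinarith
  refine ⟨?_, a, ha0, ?_⟩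
  · have hz : ∀ s ∈ Set.Icc (0:ℝ) 1, ∀ t ∈ Set.Icc (0:ℝ) 1,
        f ((s : ℂ) * v + (t : ℂ) * w) = mean := by
      intro s hs t ht
      rw [hvar] at hvle
      have q1 := zero_of_int _ hI3 (fun s => intervalIntegral.integral_nonneg zero_le_one
        fun t _ => sq_nonneg _) hvle s hs
      have q2 := zero_of_int (fun t : ℝ => (f ((s : ℂ) * v + (t : ℂ) * w) - mean) ^ 2)
        (((hFc1 s).sub continuous_const).pow 2) (fun _ => sq_nonneg _) q1.le t ht
      have := pow_eq_zero_iff (two_ne_zero) |>.1 q2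
      linarith
    have hall : ∀ z, f z = mean := by
      intro z
      set D := v.re * w.im - v.im * w.re with hD
      have hD2 : D * D = 1 := by
        rw [← abs_mul_abs_self, hcovol, one_mul]
      set s : ℝ := D * (z.re * w.im - z.im * w.re) with hs
      set t : ℝ := D * (v.re * z.im - v.im * z.re) with ht
      have hz' : z = (s : ℂ) * v + (t : ℂ) * w := by
        apply Complex.ext
        · simp [hs, ht]
          linear_combination (-z.re) * hD2 + D * z.re * hD
        · simp [hs, ht]
          linear_combination (-z.im) * hD2 + D * z.im * hD
      have := hper _ (hmem ⌊s⌋ ⌊t⌋) (((Int.fract s : ℝ) : ℂ) * v + ((Int.fract t : ℝ) : ℂ) * w)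
      rw [hz _ ⟨Int.fract_nonneg _, (Int.fract_lt_one _).le⟩ _
        ⟨Int.fract_nonneg _, (Int.fract_lt_one _).le⟩] at this
      rw [← this]
      congr 1
      have es : (s : ℂ) = ((Int.fract s : ℝ) : ℂ) + (⌊s⌋ : ℂ) := by
        exact_mod_cast (Int.fract_add_floor s).symm
      have et : (t : ℂ) = ((Int.fract t : ℝ) : ℂ) + (⌊t⌋ : ℂ) := by
        exact_mod_cast (Int.fract_add_floor t).symm
      rw [hz']
      linear_combination v * es + w * et
    intro z₁ z₂
    rw [hall, hall]
  · rw [hL]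
    ext z
    exact (hlat z).trans (eis_eq τ hreeq himeq a z)
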